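/- The simple random walk on Z^d is recurrent (returns to its starting point with probability 1) if d = 1 or d = 2, and transient (return probability strictly less than 1) if d ≥ 3. -/

import Mathlib

/-- Loops of length `n` at the origin in `ℤ^d`: walks with unit lattice steps. -/
def loopZd (d n : ℕ) : Set (Fin (n+1) → Fin d → ℤ) :=
  {w | w 0 = 0 ∧ w (Fin.last n) = 0 ∧
    ∀ i : Fin n, (∑ j, |w i.succ j - w i.castSucc j|) = 1}

/-- Indecomposable loops: nontrivial loops visiting the origin only at times `0` and `n`. -/
def indecompLoopZd (d n : ℕ) : Set (Fin (n+1) → Fin d → ℤ) :=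
  {w | w ∈ loopZd d n ∧ 0 < n ∧
    ∀ i : Fin (n+1), w i = 0 → i = 0 ∨ i = Fin.last n}

/-- `p n`: probability the simple random walk on `ℤ^d` first returns to its start at time `n`. -/
noncomputable def firstReturnProb (d n : ℕ) : ℝ :=
  ((indecompLoopZd d n).ncard : ℝ) / (2 * d) ^ n

/-- The probability that the simple random walk on `ℤ^d` ever returns to its start. -/
noncomputable def returnProbability (d : ℕ) : ℝ := ∑' n : ℕ, firstReturnProb d n

open Finset

/-- The lattice unit vector with the given direction and sign. -/
def stepVec {d : ℕ} (s : Fin d × ℤˣ) : Fin d → ℤ := Pi.single s.1 (s.2 : ℤ)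

lemma stepVec_injective {d : ℕ} : Function.Injective (stepVec (d := d)) := by
  rintro ⟨i, a⟩ ⟨j, b⟩ h
  simp only [stepVec] at h
  have hij : i = j := by
    by_contra hne
    have := congrFun h i
    simp [hne] at this
  subst hij
  have := congrFun h i
  simp only [Pi.single_eq_same] at this
  simp [Units.ext_iff, this]

lemma sum_abs_eq_one_iff {d : ℕ} (v : Fin d → ℤ) :
    (∑ j, |v j|) = 1 ↔ ∃ s, v = stepVec s := by
  constructor
  · intro h
    obtain ⟨i, hi⟩ : ∃ i, v i ≠ 0 := by
      by_contra! hv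
      simp [hv] at h
    have hsplit := Finset.add_sum_erase univ (fun j => |v j|) (mem_univ i)
    have hnonneg : ∀ j ∈ univ.erase i, 0 ≤ |v j| := fun j _ => abs_nonneg _
    have hpos : 1 ≤ |v i| := Int.one_le_abs hi
    have hrest : ∑ j ∈ univ.erase i, |v j| = 0 := by
      have := Finset.sum_nonneg hnonneg
      omega
    have habs : |v i| = 1 := by omega
    have hzero := (Finset.sum_eq_zero_iff_of_nonneg hnonneg).1 hrest
    obtain ⟨u, hu⟩ : IsUnit (v i) := Int.isUnit_iff_abs_eq.2 habs
    refine ⟨(i, u), funext fun j => ?_⟩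
    by_cases hj : j = i
    · subst hj; simp [stepVec, hu]
    · simpa [stepVec, hj] using hzero j (by simp [hj])
  · rintro ⟨⟨i, u⟩, rfl⟩
    rw [Finset.sum_eq_single i]
    · simpa [stepVec] using Int.isUnit_iff_abs_eq.1 u.isUnit
    · intro j _ hj; simp [stepVec, hj]
    · simp

/-- The number of `n`-step walks in `ℤ^d` from the origin to `x`. -/
def walkCount (d : ℕ) : ℕ → (Fin d → ℤ) → ℕ
  | 0, x => if x = 0 then 1 else 0
  | n + 1, x => ∑ s : Fin d × ℤˣ, walkCount d n (x - stepVec s)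

/-- The number of `n`-step walks in `ℤ^d` from the origin to `x` which do not come back to the
origin at any positive time. -/
def avoidCount (d : ℕ) : ℕ → (Fin d → ℤ) → ℕ
  | 0, x => if x = 0 then 1 else 0
  | n + 1, x => if x = 0 then 0 else ∑ s : Fin d × ℤˣ, avoidCount d n (x - stepVec s)

/-- The number of walks in `ℤ^d` returning to the origin for the first time after `n` steps. -/
def firstReturnCount (d : ℕ) : ℕ → ℕ
  | 0 => 0
  | n + 1 => ∑ s : Fin d × ℤˣ, avoidCount d n (0 - stepVec s)

/-- Decomposition of a walk at its last visit to the origin. -/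
lemma walkCount_eq_sum_avoidCount (d n : ℕ) (x : Fin d → ℤ) :
    walkCount d n x = ∑ k ∈ range (n + 1), walkCount d k 0 * avoidCount d (n - k) x := by
  induction n generalizing x with
  | zero => simp [walkCount, avoidCount]
  | succ n ih =>
    rw [sum_range_succ, Nat.sub_self]
    by_cases hx : x = 0
    · subst hx
      rw [Finset.sum_eq_zero]
      · simp [avoidCount]
      · intro k hk
        have : n + 1 - k = (n - k) + 1 := by have := mem_range.1 hk; omega
        simp [this, avoidCount]
    · simp only [walkCount, avoidCount, hx, if_false, mul_zero, add_zero, ih]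
      rw [sum_comm]
      refine sum_congr rfl fun k hk => ?_
      have : n + 1 - k = (n - k) + 1 := by have := mem_range.1 hk; omega
      rw [this, ← mul_sum]
      simp [avoidCount, hx]

lemma walkCount_renewal (d n : ℕ) :
    walkCount d (n + 1) 0 =
      ∑ k ∈ range (n + 1), walkCount d k 0 * firstReturnCount d (n + 1 - k) := by
  simp only [walkCount]
  simp_rw [walkCount_eq_sum_avoidCount d n (0 - stepVec _)]
  rw [sum_comm]
  refine sum_congr rfl fun k hk => ?_
  have : n + 1 - k = (n - k) + 1 := by have := mem_range.1 hk; omega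
  rw [this, ← mul_sum]
  simp [firstReturnCount]

lemma ncard_walks_snoc {d n : ℕ} (x : Fin d → ℤ) (F : (Fin d → ℤ) → Set (Fin (n + 1) → Fin d → ℤ))
    (hfin : ∀ y, (F y).Finite) (hend : ∀ y, ∀ w ∈ F y, w (Fin.last n) = y) :
    {w : Fin (n + 2) → Fin d → ℤ |
        w (Fin.last (n + 1)) = x ∧ ∃ s, Fin.init w ∈ F (x - stepVec s)}.Finite ∧
      {w : Fin (n + 2) → Fin d → ℤ |
        w (Fin.last (n + 1)) = x ∧ ∃ s, Fin.init w ∈ F (x - stepVec s)}.ncard =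
        ∑ s, (F (x - stepVec s)).ncard := by
  have himage : {w : Fin (n + 2) → Fin d → ℤ |
        w (Fin.last (n + 1)) = x ∧ ∃ s, Fin.init w ∈ F (x - stepVec s)} =
      (fun w : Fin (n + 1) → Fin d → ℤ => (Fin.snoc w x : Fin (n + 2) → Fin d → ℤ)) ''
        ⋃ s, F (x - stepVec s) := by
    ext w
    simp only [Set.mem_ofPred_eq, Set.mem_image, Set.mem_iUnion]
    constructor
    · rintro ⟨rfl, h⟩
      exact ⟨Fin.init w, h, Fin.snoc_init_self w⟩
    · rintro ⟨v, h, rfl⟩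
      simpa using h
  have hinj : Function.Injective
      (fun w : Fin (n + 1) → Fin d → ℤ => (Fin.snoc w x : Fin (n + 2) → Fin d → ℤ)) :=
    fun v w h => by simpa using congrArg Fin.init h
  rw [himage]
  refine ⟨(Set.finite_iUnion fun s => hfin _).image _, ?_⟩
  rw [Set.ncard_image_of_injective _ hinj, Set.ncard_iUnion_of_finite (fun s => hfin _),
    finsum_eq_sum_of_fintype]
  intro s t hst
  refine Set.disjoint_left.2 fun w hs ht => hst (stepVec_injective ?_)
  have := (hend _ w hs).symm.trans (hend _ w ht)
  simpa using this

/-- Walks from the origin to `x` in `n` steps which visit the origin only at time `0`. -/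
def avoidSet (d n : ℕ) (x : Fin d → ℤ) : Set (Fin (n + 1) → Fin d → ℤ) :=
  {w | w 0 = 0 ∧ w (Fin.last n) = x ∧
    (∀ i : Fin n, (∑ j, |w i.succ j - w i.castSucc j|) = 1) ∧ ∀ i, w i = 0 → i = 0}

lemma exists_init_mem_avoidSet_iff {d n : ℕ} (x : Fin d → ℤ) (w : Fin (n + 2) → Fin d → ℤ)
    (hw : w (Fin.last (n + 1)) = x) :
    (∃ s, Fin.init w ∈ avoidSet d n (x - stepVec s)) ↔
      w 0 = 0 ∧ (∀ i : Fin (n + 1), (∑ j, |w i.succ j - w i.castSucc j|) = 1) ∧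
        ∀ i : Fin (n + 1), w i.castSucc = 0 → i = 0 := by
  have hlast := sum_abs_eq_one_iff (w (Fin.last n).succ - w (Fin.last n).castSucc)
  simp only [Pi.sub_apply] at hlast
  rw [Fin.forall_fin_succ' (P := fun i => (∑ j, |w i.succ j - w i.castSucc j|) = 1), hlast]
  simp only [avoidSet, Fin.init, Set.mem_ofPred_eq, Fin.castSucc_zero, Fin.succ_last, hw,
    ← Fin.succ_castSucc]
  constructor
  · rintro ⟨s, h0, hs, hsteps, hav⟩
    exact ⟨h0, ⟨hsteps, s, by rw [hs]; abel⟩, hav⟩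
  · rintro ⟨h0, ⟨hsteps, s, hs⟩, hav⟩
    exact ⟨s, h0, by rw [← hs]; abel, hsteps, hav⟩

lemma avoidSet_zero (d : ℕ) (x : Fin d → ℤ) :
    avoidSet d 0 x = if x = 0 then {0} else ∅ := by
  split_ifs with hx
  · subst hx
    ext w
    simp only [avoidSet, Set.mem_ofPred_eq, Set.mem_singleton_iff]
    constructor
    · rintro ⟨h, -⟩
      funext i
      rw [Subsingleton.elim (α := Fin 1) i 0, h]; rfl
    · rintro rfl
      exact ⟨rfl, rfl, fun i => i.elim0, fun i _ => Subsingleton.elim (α := Fin 1) _ _⟩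
  · ext w
    simp only [avoidSet, Set.mem_ofPred_eq, Set.mem_empty_iff_false, iff_false]
    rintro ⟨h, h', -⟩
    exact hx (h'.symm.trans h)

lemma avoidSet_succ (d n : ℕ) (x : Fin d → ℤ) (hx : x ≠ 0) :
    avoidSet d (n + 1) x = {w : Fin (n + 2) → Fin d → ℤ |
        w (Fin.last (n + 1)) = x ∧ ∃ s, Fin.init w ∈ avoidSet d n (x - stepVec s)} := by
  ext w
  simp only [Set.mem_ofPred_eq]
  by_cases hw : w (Fin.last (n + 1)) = x
  · rw [exists_init_mem_avoidSet_iff x w hw]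
    simp only [avoidSet, Set.mem_ofPred_eq, Fin.forall_fin_succ' (P := fun i => w i = 0 → i = 0), hw,
      hx, Fin.castSucc_eq_zero_iff]
    tauto
  · simp [avoidSet, hw]

lemma avoidSet_finite_and_ncard (d n : ℕ) (x : Fin d → ℤ) :
    (avoidSet d n x).Finite ∧ (avoidSet d n x).ncard = avoidCount d n x := by
  induction n generalizing x with
  | zero => rw [avoidSet_zero, avoidCount]; split_ifs <;> simp
  | succ n ih =>
    by_cases hx : x = 0
    · have : avoidSet d (n + 1) x = ∅ := by
        ext w
        simp only [avoidSet, Set.mem_ofPred_eq, Set.mem_empty_iff_false, iff_false]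
        rintro ⟨-, h, -, h'⟩
        exact (Fin.last_pos (n := n)).ne' (h' _ (h.trans hx))
      rw [this]
      simp [avoidCount, hx]
    · rw [avoidSet_succ d n x hx]
      have := ncard_walks_snoc x (avoidSet d n) (fun y => (ih y).1) (fun y w hw => hw.2.1)
      refine ⟨this.1, ?_⟩
      rw [this.2, avoidCount, if_neg hx]
      exact sum_congr rfl fun s _ => (ih _).2

lemma ncard_indecompLoopZd (d n : ℕ) : (indecompLoopZd d n).ncard = firstReturnCount d n := by
  cases n with
  | zero => simp [indecompLoopZd, firstReturnCount]
  | succ n =>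
    have hset : indecompLoopZd d (n + 1) = {w : Fin (n + 2) → Fin d → ℤ |
        w (Fin.last (n + 1)) = 0 ∧ ∃ s, Fin.init w ∈ avoidSet d n (0 - stepVec s)} := by
      ext w
      simp only [Set.mem_ofPred_eq]
      by_cases hw : w (Fin.last (n + 1)) = 0
      · rw [exists_init_mem_avoidSet_iff 0 w hw]
        simp only [indecompLoopZd, loopZd, Set.mem_ofPred_eq, hw,
          Fin.forall_fin_succ' (P := fun i => w i = 0 → i = 0 ∨ i = Fin.last (n + 1)),
          Fin.castSucc_eq_zero_iff, (Fin.castSucc_lt_last _).ne]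
        simp [and_assoc]
      · simp [indecompLoopZd, loopZd, hw]
    rw [hset, (ncard_walks_snoc 0 (avoidSet d n) (fun y => (avoidSet_finite_and_ncard d n y).1)
      (fun y w hw => hw.2.1)).2, firstReturnCount]
    exact sum_congr rfl fun s _ => (avoidSet_finite_and_ncard d n _).2

lemma walkCount_le (d n : ℕ) (x : Fin d → ℤ) : walkCount d n x ≤ (2 * d) ^ n := by
  induction n generalizing x with
  | zero => rw [walkCount]; split_ifs <;> simp
  | succ n ih =>
    calc walkCount d (n + 1) x ≤ ∑ _s : Fin d × ℤˣ, (2 * d) ^ n := sum_le_sum fun s _ => ih _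
      _ = (2 * d) ^ (n + 1) := by simp [Fintype.card_units_int]; ring

lemma append_eq_zero_iff {a b : ℕ} (x : Fin a → ℤ) (y : Fin b → ℤ) :
    Fin.append x y = 0 ↔ x = 0 ∧ y = 0 := by
  simp [funext_iff, Fin.forall_fin_add]

lemma append_sub_stepVec_castAdd {a b : ℕ} (x : Fin a → ℤ) (y : Fin b → ℤ) (i : Fin a) (u : ℤˣ) :
    Fin.append x y - stepVec (Fin.castAdd b i, u) = Fin.append (x - stepVec (i, u)) y := by
  funext j
  refine Fin.addCases (fun j => ?_) (fun j => ?_) j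
  · simp [stepVec, Pi.single_apply]
  · simp [stepVec, Pi.single_apply, Fin.ext_iff]
    omega

lemma append_sub_stepVec_natAdd {a b : ℕ} (x : Fin a → ℤ) (y : Fin b → ℤ) (i : Fin b) (u : ℤˣ) :
    Fin.append x y - stepVec (Fin.natAdd a i, u) = Fin.append x (y - stepVec (i, u)) := by
  funext j
  refine Fin.addCases (fun j => ?_) (fun j => ?_) j
  · simp [stepVec, Pi.single_apply, Fin.ext_iff]
    omega
  · simp [stepVec, Pi.single_apply]

/-- A walk in `ℤ^(a+b)` is a shuffle of a walk in `ℤ^a` and a walk in `ℤ^b`. -/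
lemma walkCount_append (a b n : ℕ) (x : Fin a → ℤ) (y : Fin b → ℤ) :
    walkCount (a + b) n (Fin.append x y) =
      ∑ k ∈ range (n + 1), n.choose k * (walkCount a k x * walkCount b (n - k) y) := by
  induction n generalizing x y with
  | zero => simp [walkCount, append_eq_zero_iff, ← ite_and, and_comm]
  | succ n ih =>
    have hpascal := sum_choose_succ_mul (fun k l => walkCount a k x * walkCount b l y) n
    simp only [Nat.cast_id] at hpascal
    rw [hpascal, walkCount, Fintype.sum_prod_type, Fin.sum_univ_add]
    simp only [append_sub_stepVec_castAdd, append_sub_stepVec_natAdd, ih]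
    rw [add_comm]
    congr 1
    · rw [← Fintype.sum_prod_type'
        (f := fun i u => ∑ k ∈ range (n + 1),
          n.choose k * (walkCount a k x * walkCount b (n - k) (y - stepVec (i, u)))), sum_comm]
      refine sum_congr rfl fun k hk => ?_
      have : n + 1 - k = (n - k) + 1 := by have := mem_range.1 hk; omega
      rw [this, ← mul_sum, ← mul_sum]
      rfl
    · rw [← Fintype.sum_prod_type'
        (f := fun i u => ∑ k ∈ range (n + 1),
          n.choose k * (walkCount a k (x - stepVec (i, u)) * walkCount b (n - k) y)), sum_comm]
      refine sum_congr rfl fun k hk => ?_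
      rw [← mul_sum, ← sum_mul]
      rfl

lemma walkCount_add_zero (a b n : ℕ) :
    walkCount (a + b) n 0 =
      ∑ k ∈ range (n + 1), n.choose k * (walkCount a k 0 * walkCount b (n - k) 0) := by
  rw [← walkCount_append, (append_eq_zero_iff 0 0).2 ⟨rfl, rfl⟩]

lemma sum_intUnits {M : Type*} [AddCommMonoid M] (f : ℤˣ → M) : ∑ u, f u = f 1 + f (-1) := by
  rw [show (univ : Finset ℤˣ) = {1, -1} from rfl, sum_pair (by decide)]

lemma walkCount_one_succ (n : ℕ) (m : ℤ) :
    walkCount 1 (n + 1) (fun _ => m) =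
      walkCount 1 n (fun _ => m - 1) + walkCount 1 n (fun _ => m + 1) := by
  rw [walkCount, Fintype.sum_prod_type, Fin.sum_univ_one, sum_intUnits]
  congr 2 <;> funext j <;> simp [stepVec, Subsingleton.elim j 0]

lemma walkCount_one_of_lt (n : ℕ) (m : ℤ) (hm : m < -n) : walkCount 1 n (fun _ => m) = 0 := by
  induction n generalizing m with
  | zero =>
    have : m ≠ 0 := by simp at hm; omega
    simp [walkCount, funext_iff, this]
  | succ n ih =>
    rw [walkCount_one_succ, ih _ (by push_cast at hm; omega), ih _ (by push_cast at hm; omega)]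

lemma walkCount_one_of_odd (n : ℕ) (m : ℤ) (hm : Odd (n + m)) : walkCount 1 n (fun _ => m) = 0 := by
  induction n generalizing m with
  | zero =>
    have : m ≠ 0 := by rintro rfl; simp at hm
    simp [walkCount, funext_iff, this]
  | succ n ih =>
    rw [Int.odd_iff] at hm
    push_cast at hm
    rw [walkCount_one_succ, ih _ (by rw [Int.odd_iff]; omega), ih _ (by rw [Int.odd_iff]; omega)]

lemma walkCount_one_eq_choose (n k : ℕ) : walkCount 1 n (fun _ => 2 * k - n) = n.choose k := by
  induction n generalizing k with
  | zero => cases k <;> simp [walkCount, funext_iff]; omega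
  | succ n ih =>
    rw [walkCount_one_succ]
    cases k with
    | zero =>
      rw [walkCount_one_of_lt _ _ (by push_cast; omega)]
      have := ih 0
      rw [Nat.choose_zero_right] at this ⊢
      rw [zero_add, show (2 * ((0 : ℕ) : ℤ) - (n + 1 : ℕ) + 1) = 2 * (0 : ℕ) - n by push_cast; ring,
        this]
    | succ k =>
      rw [Nat.choose_succ_succ, ← ih, ← ih]
      congr 2 <;> funext _ <;> push_cast <;> ring

lemma walkCount_one_two_mul (j : ℕ) : walkCount 1 (2 * j) 0 = j.centralBinom := by
  rw [Nat.centralBinom, ← walkCount_one_eq_choose]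
  congr 1
  funext _
  simp

/-- Rotating the plane by `π/4` turns the simple random walk on `ℤ^2` into a pair of independent
simple random walks on `ℤ`. -/
lemma walkCount_two (n : ℕ) (x : Fin 2 → ℤ) :
    walkCount 2 n x =
      walkCount 1 n (fun _ => x 0 + x 1) * walkCount 1 n (fun _ => x 0 - x 1) := by
  induction n generalizing x with
  | zero =>
    simp only [walkCount, funext_iff, Fin.forall_fin_two, Pi.zero_apply, forall_const]
    split_ifs <;> first | rfl | omega
  | succ n ih =>
    rw [walkCount, Fintype.sum_prod_type, Fin.sum_univ_two, sum_intUnits, sum_intUnits]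
    simp only [ih, walkCount_one_succ]
    simp [stepVec]
    ring_nf

lemma walkCount_two_zero (n : ℕ) : walkCount 2 n 0 = walkCount 1 n 0 ^ 2 := by
  rw [walkCount_two, sq]
  rfl

lemma centralBinom_sq_mul_le (j : ℕ) : j.centralBinom ^ 2 * (2 * j + 1) ≤ 16 ^ j := by
  induction j with
  | zero => simp
  | succ j ih =>
    have h := Nat.succ_mul_centralBinom_succ j
    refine le_of_mul_le_mul_left (a := (j + 1) ^ 2) ?_ (by positivity)
    calc (j + 1) ^ 2 * ((j + 1).centralBinom ^ 2 * (2 * (j + 1) + 1))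
        = ((j + 1) * (j + 1).centralBinom) ^ 2 * (2 * j + 3) := by ring
      _ = 4 * (2 * j + 1) * (2 * j + 3) * (j.centralBinom ^ 2 * (2 * j + 1)) := by rw [h]; ring
      _ ≤ 4 * (2 * j + 1) * (2 * j + 3) * 16 ^ j := by gcongr
      _ ≤ 16 * (j + 1) ^ 2 * 16 ^ j := Nat.mul_le_mul_right _ (by nlinarith)
      _ = (j + 1) ^ 2 * 16 ^ (j + 1) := by ring

lemma le_mul_centralBinom_sq (j : ℕ) (hj : 1 ≤ j) : 16 ^ j ≤ 4 * j * j.centralBinom ^ 2 := by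
  induction j, hj using Nat.le_induction with
  | base => decide
  | succ j hj ih =>
    have h := Nat.succ_mul_centralBinom_succ j
    refine le_of_mul_le_mul_left (a := (j + 1) ^ 2 * j) ?_ (by positivity)
    calc (j + 1) ^ 2 * j * 16 ^ (j + 1) = 16 * (j + 1) * (j * (j + 1)) * 16 ^ j := by ring
      _ ≤ 16 * (j + 1) * (j * (j + 1)) * (4 * j * j.centralBinom ^ 2) := by gcongr
      _ = 4 * (j + 1) * j * 4 * j.centralBinom ^ 2 * (4 * (j * (j + 1))) := by ring
      _ ≤ 4 * (j + 1) * j * 4 * j.centralBinom ^ 2 * (2 * j + 1) ^ 2 := by gcongr; nlinarith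
      _ = 4 * (j + 1) * j * (2 * (2 * j + 1) * j.centralBinom) ^ 2 := by ring
      _ = 4 * (j + 1) * j * ((j + 1) * (j + 1).centralBinom) ^ 2 := by rw [h]
      _ = (j + 1) ^ 2 * j * (4 * (j + 1) * (j + 1).centralBinom ^ 2) := by ring

lemma walkCount_two_mul_le (n : ℕ) : walkCount 2 n 0 * (n + 1) ≤ 4 ^ n := by
  rw [walkCount_two_zero]
  rcases Nat.even_or_odd' n with ⟨j, rfl | rfl⟩
  · rw [walkCount_one_two_mul, pow_mul]
    exact centralBinom_sq_mul_le j
  · have : walkCount 1 (2 * j + 1) 0 = 0 := walkCount_one_of_odd _ 0 (by simp)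
    simp [this]

section Renewal

variable {u f : ℕ → ℝ}

lemma renewal_sum_eq (hu0 : u 0 = 1) (hf0 : f 0 = 0)
    (h : ∀ n, u (n + 1) = ∑ k ∈ range (n + 1), u k * f (n + 1 - k)) (N : ℕ) :
    ∑ n ∈ range (N + 1), u n =
      1 + ∑ k ∈ range (N + 1), u k * ∑ j ∈ range (N + 1 - k), f j := by
  induction N with
  | zero => simp [hu0, hf0]
  | succ N ih =>
    rw [sum_range_succ, ih, h N, sum_range_succ (n := N + 1), add_assoc, ← sum_add_distrib]
    simp only [Nat.add_sub_cancel_left, range_one, sum_singleton, hf0, mul_zero, add_zero]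
    congr 1
    refine sum_congr rfl fun k hk => ?_
    have : N + 1 + 1 - k = (N + 1 - k) + 1 := by have := mem_range.1 hk; omega
    rw [this, sum_range_succ, mul_add]

lemma renewal_sum_le (hu0 : u 0 = 1) (hu : ∀ n, 0 ≤ u n) (hf0 : f 0 = 0) (hf : ∀ n, 0 ≤ f n)
    (h : ∀ n, u (n + 1) = ∑ k ∈ range (n + 1), u k * f (n + 1 - k)) (N : ℕ) :
    ∑ n ∈ range (N + 1), u n ≤
      1 + (∑ k ∈ range (N + 1), u k) * ∑ j ∈ range (N + 1), f j := by
  refine (renewal_sum_eq hu0 hf0 h N).le.trans ?_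
  rw [sum_mul]
  gcongr with k hk
  · exact hu k
  · exact fun j _ _ => hf j
  · exact Nat.sub_le _ _

lemma le_renewal_sum (hu0 : u 0 = 1) (hu : ∀ n, 0 ≤ u n) (hf0 : f 0 = 0) (hf : ∀ n, 0 ≤ f n)
    (h : ∀ n, u (n + 1) = ∑ k ∈ range (n + 1), u k * f (n + 1 - k)) (M K : ℕ) :
    1 + (∑ k ∈ range M, u k) * ∑ j ∈ range K, f j ≤ ∑ n ∈ range (M + K + 1), u n := by
  rw [renewal_sum_eq hu0 hf0 h (M + K), sum_mul]
  gcongr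
  calc ∑ k ∈ range M, u k * ∑ j ∈ range K, f j
      ≤ ∑ k ∈ range M, u k * ∑ j ∈ range (M + K + 1 - k), f j := by
        refine sum_le_sum fun k hk => mul_le_mul_of_nonneg_left ?_ (hu k)
        refine sum_le_sum_of_subset_of_nonneg (range_subset_range.2 ?_) fun j _ _ => hf j
        have := mem_range.1 hk
        omega
    _ ≤ ∑ k ∈ range (M + K + 1), u k * ∑ j ∈ range (M + K + 1 - k), f j :=
        sum_le_sum_of_subset_of_nonneg (range_subset_range.2 (by omega))
          fun k _ _ => mul_nonneg (hu k) (sum_nonneg fun j _ => hf j)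

lemma tsum_lt_one_of_renewal_summable (hu0 : u 0 = 1) (hu : ∀ n, 0 ≤ u n) (hf0 : f 0 = 0)
    (hf : ∀ n, 0 ≤ f n) (h : ∀ n, u (n + 1) = ∑ k ∈ range (n + 1), u k * f (n + 1 - k))
    (hsum : Summable u) : ∑' n, f n < 1 := by
  have hpos : 0 < ∑' n, u n :=
    hsum.tsum_pos hu 0 (by rw [hu0]; exact one_pos)
  have hbound : ∀ K, ∑ j ∈ range K, f j ≤ 1 - 1 / ∑' n, u n := by
    intro K
    have hle : ∀ M, 1 + (∑ k ∈ range M, u k) * ∑ j ∈ range K, f j ≤ ∑' n, u n := fun M =>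
      (le_renewal_sum hu0 hu hf0 hf h M K).trans (hsum.sum_le_tsum _ fun n _ => hu n)
    have := le_of_tendsto' ((hsum.hasSum.tendsto_sum_nat.mul_const _).const_add 1) hle
    rw [le_sub_iff_add_le, ← le_sub_iff_add_le', div_le_iff₀ hpos]
    linarith
  calc ∑' n, f n ≤ 1 - 1 / ∑' n, u n := Real.tsum_le_of_sum_range_le hf hbound
    _ < 1 := by have := one_div_pos.2 hpos; linarith

lemma tsum_eq_one_of_renewal_not_summable (hu0 : u 0 = 1) (hu : ∀ n, 0 ≤ u n) (hu1 : ∀ n, u n ≤ 1)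
    (hf0 : f 0 = 0) (hf : ∀ n, 0 ≤ f n)
    (h : ∀ n, u (n + 1) = ∑ k ∈ range (n + 1), u k * f (n + 1 - k))
    (hsum : ¬ Summable u) : ∑' n, f n = 1 := by
  have htop := (not_summable_iff_tendsto_nat_atTop_of_nonneg hu).1 hsum
  have hbound : ∀ K, ∑ j ∈ range K, f j ≤ 1 := by
    intro K
    by_contra! hK
    obtain ⟨M, hM⟩ := (htop.eventually_gt_atTop ((K : ℝ) / (∑ j ∈ range K, f j - 1))).exists
    rw [div_lt_iff₀ (by linarith)] at hM
    have h1 := le_renewal_sum hu0 hu hf0 hf h M K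
    rw [add_assoc, sum_range_add] at h1
    have h2 : ∑ k ∈ range (K + 1), u (M + k) ≤ K + 1 := by
      calc ∑ k ∈ range (K + 1), u (M + k) ≤ ∑ _k ∈ range (K + 1), (1 : ℝ) :=
            sum_le_sum fun k _ => hu1 _
        _ = K + 1 := by simp
    linarith
  have hfsum : Summable f := summable_of_sum_range_le hf hbound
  refine le_antisymm (Real.tsum_le_of_sum_range_le hf hbound) ?_
  by_contra! hlt
  obtain ⟨N, hN⟩ := ((Filter.tendsto_add_atTop_iff_nat 1).2 htop).eventually_gt_atTop
    (1 / (1 - ∑' n, f n)) |>.exists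
  rw [div_lt_iff₀ (by linarith)] at hN
  have h1 := renewal_sum_le hu0 hu hf0 hf h N
  have h2 : ∑ j ∈ range (N + 1), f j ≤ ∑' n, f n := hfsum.sum_le_tsum _ fun n _ => hf n
  have h3 := mul_le_mul_of_nonneg_left h2 (sum_nonneg fun k (_ : k ∈ range (N + 1)) => hu k)
  linarith

end Renewal

/-- The probability that the simple random walk on `ℤ^d` is at its start at time `n`. -/
noncomputable def loopProb (d n : ℕ) : ℝ := (walkCount d n 0 : ℝ) / (2 * d) ^ n

lemma loopProb_zero (d : ℕ) : loopProb d 0 = 1 := by simp [loopProb, walkCount]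

lemma loopProb_nonneg (d n : ℕ) : 0 ≤ loopProb d n := by unfold loopProb; positivity

lemma loopProb_le_one (d n : ℕ) : loopProb d n ≤ 1 := by
  refine div_le_one_of_le₀ ?_ (by positivity)
  exact_mod_cast walkCount_le d n 0

lemma firstReturnProb_eq (d n : ℕ) :
    firstReturnProb d n = (firstReturnCount d n : ℝ) / (2 * d) ^ n := by
  rw [firstReturnProb, ncard_indecompLoopZd]

lemma firstReturnProb_zero (d : ℕ) : firstReturnProb d 0 = 0 := by
  simp [firstReturnProb_eq, firstReturnCount]

lemma firstReturnProb_nonneg (d n : ℕ) : 0 ≤ firstReturnProb d n := by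
  unfold firstReturnProb; positivity

lemma loopProb_renewal (d n : ℕ) :
    loopProb d (n + 1) = ∑ k ∈ range (n + 1), loopProb d k * firstReturnProb d (n + 1 - k) := by
  rw [loopProb, walkCount_renewal, Nat.cast_sum, sum_div]
  refine sum_congr rfl fun k hk => ?_
  have : n + 1 = k + (n + 1 - k) := by have := mem_range.1 hk; omega
  rw [loopProb, firstReturnProb_eq, div_mul_div_comm, ← pow_add, ← this, Nat.cast_mul]

lemma one_div_le_loopProb_two (j : ℕ) : 1 / (4 * ((j + 1 : ℕ) : ℝ)) ≤ loopProb 2 (2 * (j + 1)) := by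
  have h := le_mul_centralBinom_sq (j + 1) (by omega)
  rw [loopProb, walkCount_two_zero, walkCount_one_two_mul, div_le_div_iff₀ (by positivity)
    (by positivity), pow_mul]
  norm_num only
  rw [one_mul, mul_comm]
  exact_mod_cast h

lemma loopProb_two_eq (n : ℕ) : loopProb 2 n = loopProb 1 n ^ 2 := by
  rw [loopProb, loopProb, walkCount_two_zero, div_pow, ← pow_mul, mul_comm n 2, pow_mul]
  norm_num

lemma not_summable_loopProb_two : ¬ Summable (loopProb 2) := by
  intro h
  have heven : Summable fun j : ℕ => loopProb 2 (2 * (j + 1)) :=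
    h.comp_injective (i := fun j : ℕ => 2 * (j + 1)) fun a b hab => by simpa using hab
  have hharm := Summable.of_nonneg_of_le (fun j => by positivity) one_div_le_loopProb_two heven
  have := (hharm.mul_left 4).congr (g := fun j : ℕ => (((j + 1 : ℕ) : ℝ))⁻¹) fun j => by
    field_simp
  exact Real.not_summable_natCast_inv ((summable_nat_add_iff 1).1 this)

lemma not_summable_loopProb_one : ¬ Summable (loopProb 1) := fun h =>
  not_summable_loopProb_two <| h.of_nonneg_of_le (loopProb_nonneg 2) fun n => by
    rw [loopProb_two_eq, sq]
    exact mul_le_of_le_one_left (loopProb_nonneg 1 n) (loopProb_le_one 1 n)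

section BinomialMoments

variable {x y : ℝ}

lemma choose_div_succ (n k : ℕ) :
    (n.choose k : ℝ) / (k + 1) = ((n + 1).choose (k + 1) : ℝ) / (n + 1) := by
  rw [div_eq_div_iff (by positivity) (by positivity)]
  have := Nat.add_one_mul_choose_eq n k
  rw [mul_comm]
  exact_mod_cast this

lemma sum_choose_div_succ_le (hx : 0 < x) (hy : 0 ≤ y) (n : ℕ) :
    ∑ k ∈ range (n + 1), n.choose k * x ^ k * y ^ (n - k) / (k + 1) ≤
      (x + y) ^ (n + 1) / (x * (n + 1)) := by
  rw [le_div_iff₀ (by positivity), add_pow, sum_range_succ' (n := n + 1), sum_mul]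
  refine (sum_le_sum fun k hk => le_of_eq ?_).trans (le_add_of_nonneg_right (by positivity))
  have h := choose_div_succ n k
  rw [div_eq_div_iff (by positivity) (by positivity)] at h
  rw [Nat.add_sub_add_right, div_mul_eq_mul_div, div_eq_iff (by positivity)]
  linear_combination x ^ (k + 1) * y ^ (n - k) * h

lemma sum_choose_div_succ_mul_succ_le (hx : 0 < x) (hy : 0 < y) (n : ℕ) :
    ∑ k ∈ range (n + 1), n.choose k * x ^ k * y ^ (n - k) / ((k + 1) * ((n - k : ℕ) + 1)) ≤
      (x + y) ^ (n + 2) / (x * y * ((n + 1) * (n + 2))) := by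
  calc ∑ k ∈ range (n + 1), n.choose k * x ^ k * y ^ (n - k) / ((k + 1) * ((n - k : ℕ) + 1))
      = ∑ k ∈ range (n + 1), ((n + 1).choose (n - k) * y ^ (n - k) * x ^ (n + 1 - (n - k)) /
          ((n - k : ℕ) + 1)) / (x * (n + 1)) := by
        refine sum_congr rfl fun k hk => ?_
        have hk' : k ≤ n := Nat.lt_succ_iff.1 (mem_range.1 hk)
        have h := choose_div_succ n k
        rw [div_eq_div_iff (by positivity) (by positivity)] at h
        rw [show n + 1 - (n - k) = k + 1 by omega,
          Nat.choose_symm_of_eq_add (show n + 1 = (n - k) + (k + 1) by omega)]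
        rw [div_div, div_eq_div_iff (by positivity) (by positivity)]
        linear_combination x ^ (k + 1) * y ^ (n - k) * ((n - k : ℕ) + 1) * h
    _ = (∑ k ∈ range (n + 1), (n + 1).choose k * y ^ k * x ^ (n + 1 - k) / ((k : ℝ) + 1)) /
          (x * (n + 1)) := by
        rw [← sum_div, ← sum_range_reflect (fun k : ℕ =>
          ((n + 1).choose k : ℝ) * y ^ k * x ^ (n + 1 - k) / ((k : ℝ) + 1))]
        simp only [Nat.add_sub_cancel]
    _ ≤ ((y + x) ^ (n + 1 + 1) / (y * ((n + 1 : ℕ) + 1))) / (x * (n + 1)) := by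
        gcongr
        refine le_trans ?_ (sum_choose_div_succ_le hy hx.le (n + 1))
        exact sum_le_sum_of_subset_of_nonneg (range_subset_range.2 (by omega))
          fun k _ _ => by positivity
    _ = (x + y) ^ (n + 2) / (x * y * ((n + 1) * (n + 2))) := by
        rw [div_div, add_comm y x]
        push_cast
        ring_nf

end BinomialMoments

/-- For `t = (n + 1) ^ (1 / 2)` the bound is `2 ^ n * (n + 1) ^ (-1 / 2)`. -/
lemma walkCount_one_le (n : ℕ) {t : ℝ} (ht : 0 < t) :
    (walkCount 1 n 0 : ℝ) ≤ 2 ^ n * ((t / (n + 1) + 1 / t) / 2) := by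
  have hsq : (walkCount 1 n 0 : ℝ) ^ 2 ≤ 4 ^ n / (n + 1) := by
    rw [le_div_iff₀ (by positivity)]
    have := walkCount_two_mul_le n
    rw [walkCount_two_zero] at this
    exact_mod_cast this
  have hfour : (4 : ℝ) ^ n = (2 ^ n) ^ 2 := by rw [← pow_mul, mul_comm, pow_mul]; norm_num
  have hamgm : 2 * (walkCount 1 n 0 : ℝ) * 2 ^ n ≤ t * walkCount 1 n 0 ^ 2 + (2 ^ n) ^ 2 / t := by
    rw [← sub_nonneg]
    have : t * (walkCount 1 n 0 : ℝ) ^ 2 + (2 ^ n) ^ 2 / t - 2 * walkCount 1 n 0 * 2 ^ n =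
        (t * walkCount 1 n 0 - 2 ^ n) ^ 2 / t := by field_simp; ring
    rw [this]
    positivity
  have hpow : (0 : ℝ) < 2 ^ n := by positivity
  refine le_of_mul_le_mul_right ?_ (mul_pos two_pos hpow)
  calc (walkCount 1 n 0 : ℝ) * (2 * 2 ^ n) = 2 * walkCount 1 n 0 * 2 ^ n := by ring
    _ ≤ t * walkCount 1 n 0 ^ 2 + (2 ^ n) ^ 2 / t := hamgm
    _ ≤ t * (4 ^ n / (n + 1)) + (2 ^ n) ^ 2 / t := by gcongr
    _ = 2 ^ n * ((t / (n + 1) + 1 / t) / 2) * (2 * 2 ^ n) := by rw [hfour]; ring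

lemma walkCount_one_add_le (m n : ℕ) {t : ℝ} (ht : 0 < t) :
    (walkCount (1 + m) n 0 : ℝ) ≤
      (2 * (1 + m : ℝ)) ^ n * ((t * (1 + m) / (n + 1) + 1 / t) / 2) := by
  calc (walkCount (1 + m) n 0 : ℝ)
      = ∑ k ∈ range (n + 1),
          n.choose k * ((walkCount 1 k 0 : ℝ) * (walkCount m (n - k) 0 : ℝ)) := by
        rw [walkCount_add_zero]; push_cast; rfl
    _ ≤ ∑ k ∈ range (n + 1),
          n.choose k * ((2 ^ k * ((t / (k + 1) + 1 / t) / 2)) * (2 * m : ℝ) ^ (n - k)) := by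
        gcongr with k hk
        · exact walkCount_one_le k ht
        · exact_mod_cast walkCount_le m (n - k) 0
    _ = t / 2 * ∑ k ∈ range (n + 1), n.choose k * 2 ^ k * (2 * m : ℝ) ^ (n - k) / (k + 1) +
          1 / (2 * t) * (2 + 2 * m) ^ n := by
        rw [add_pow, mul_sum, mul_sum, ← sum_add_distrib]
        refine sum_congr rfl fun k _ => ?_
        ring
    _ ≤ t / 2 * ((2 + 2 * m) ^ (n + 1) / (2 * (n + 1))) + 1 / (2 * t) * (2 + 2 * m) ^ n := by
        gcongr
        exact sum_choose_div_succ_le two_pos (by positivity) n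
    _ = (2 * (1 + m : ℝ)) ^ n * ((t * (1 + m) / (n + 1) + 1 / t) / 2) := by
        rw [show (2 + 2 * m : ℝ) = 2 * (1 + m) by ring, pow_succ]
        field_simp

lemma loopProb_two_add_le (b n : ℕ) (hb : 0 < b)
    (hwalk : ∀ (j : ℕ) {t : ℝ}, 0 < t →
      (walkCount b j 0 : ℝ) ≤ (2 * b : ℝ) ^ j * ((t * b / (j + 1) + 1 / t) / 2))
    {t : ℝ} (ht : 0 < t) :
    loopProb (2 + b) n ≤
      (2 + b : ℝ) ^ 2 * (t / ((n + 1) * (n + 2)) + 1 / (t * (n + 1))) := by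
  have hb' : (0 : ℝ) < b := by exact_mod_cast hb
  rw [loopProb, div_le_iff₀ (by positivity)]
  calc (walkCount (2 + b) n 0 : ℝ)
      = ∑ k ∈ range (n + 1),
          n.choose k * ((walkCount 2 k 0 : ℝ) * (walkCount b (n - k) 0 : ℝ)) := by
        rw [walkCount_add_zero]; push_cast; rfl
    _ ≤ ∑ k ∈ range (n + 1), n.choose k * ((4 ^ k / (k + 1)) *
          ((2 * b : ℝ) ^ (n - k) * ((t * b / ((n - k : ℕ) + 1) + 1 / t) / 2))) := by
        gcongr with k hk
        · rw [le_div_iff₀ (by positivity)]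
          exact_mod_cast walkCount_two_mul_le k
        · exact hwalk (n - k) ht
    _ = t * b / 2 * ∑ k ∈ range (n + 1),
            n.choose k * 4 ^ k * (2 * b : ℝ) ^ (n - k) / ((k + 1) * ((n - k : ℕ) + 1)) +
          1 / (2 * t) * ∑ k ∈ range (n + 1),
            n.choose k * 4 ^ k * (2 * b : ℝ) ^ (n - k) / (k + 1) := by
        rw [mul_sum, mul_sum, ← sum_add_distrib]
        refine sum_congr rfl fun k _ => ?_
        field_simp
    _ ≤ t * b / 2 * ((4 + 2 * b) ^ (n + 2) / (4 * (2 * b) * ((n + 1) * (n + 2)))) +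
          1 / (2 * t) * ((4 + 2 * b) ^ (n + 1) / (4 * (n + 1))) := by
        gcongr
        · exact sum_choose_div_succ_mul_succ_le (by norm_num) (by positivity) n
        · exact sum_choose_div_succ_le (by norm_num) (by positivity) n
    _ = (2 * (2 + b)) ^ n * ((2 + b) ^ 2 / 4 * (t / ((n + 1) * (n + 2))) +
          (2 + b) / 4 * (1 / (t * (n + 1)))) := by
        rw [show (4 + 2 * b : ℝ) = 2 * (2 + b) by ring, pow_succ, pow_succ]
        field_simp
    _ ≤ (2 * (2 + b)) ^ n * ((2 + b) ^ 2 * (t / ((n + 1) * (n + 2))) +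
          (2 + b) ^ 2 * (1 / (t * (n + 1)))) := by
        gcongr <;> nlinarith
    _ = (2 + b : ℝ) ^ 2 * (t / ((n + 1) * (n + 2)) + 1 / (t * (n + 1))) *
          (2 * ((2 + b : ℕ) : ℝ)) ^ n := by push_cast; ring

lemma summable_loopProb {d : ℕ} (hd : 3 ≤ d) : Summable (loopProb d) := by
  obtain ⟨m, rfl⟩ : ∃ m, d = 2 + (1 + m) := ⟨d - 3, by omega⟩
  have hp : Summable fun n : ℕ => 1 / (((n + 1 : ℕ) : ℝ) ^ (3 / 2 : ℝ)) :=
    (summable_nat_add_iff (f := fun n : ℕ => 1 / ((n : ℝ) ^ (3 / 2 : ℝ))) 1).2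
      (Real.summable_one_div_nat_rpow.2 (by norm_num))
  refine (hp.mul_left ((2 + (1 + m : ℕ) : ℝ) ^ 2 * 2)).of_nonneg_of_le
    (loopProb_nonneg _) fun n => ?_
  have hpos : (0 : ℝ) < n + 1 := by positivity
  have hsqrt : 0 < √((n : ℝ) + 1) := Real.sqrt_pos.2 hpos
  have hrpow : (((n + 1 : ℕ) : ℝ) ^ (3 / 2 : ℝ)) = (n + 1) * √((n : ℝ) + 1) := by
    rw [show (3 / 2 : ℝ) = 1 + 1 / 2 by norm_num, Nat.cast_add_one, Real.rpow_add hpos,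
      Real.rpow_one, ← Real.sqrt_eq_rpow]
  refine (loopProb_two_add_le (1 + m) n (by omega) (fun j t ht => ?_) hsqrt).trans ?_
  · simpa using walkCount_one_add_le m j ht
  · rw [hrpow, mul_assoc]
    gcongr
    calc √((n : ℝ) + 1) / ((n + 1) * (n + 2)) + 1 / (√((n : ℝ) + 1) * (n + 1))
        ≤ √((n : ℝ) + 1) / ((n + 1) * (n + 1)) + 1 / (√((n : ℝ) + 1) * (n + 1)) := by
          gcongr; norm_num
      _ = 2 * (1 / ((n + 1) * √((n : ℝ) + 1))) := by
          field_simp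
          rw [Real.sq_sqrt hpos.le]
          ring

theorem polya_random_walk (d : ℕ) :
    ((d = 1 ∨ d = 2) → returnProbability d = 1) ∧
    (3 ≤ d → returnProbability d < 1) := by
  refine ⟨fun hd => ?_, fun hd => ?_⟩
  · refine tsum_eq_one_of_renewal_not_summable (loopProb_zero d) (loopProb_nonneg d)
      (loopProb_le_one d) (firstReturnProb_zero d) (firstReturnProb_nonneg d)
      (loopProb_renewal d) ?_
    rcases hd with rfl | rfl
    · exact not_summable_loopProb_one
    · exact not_summable_loopProb_two
  · exact tsum_lt_one_of_renewal_summable (loopProb_zero d) (loopProb_nonneg d)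
      (firstReturnProb_zero d) (firstReturnProb_nonneg d) (loopProb_renewal d)
      (summable_loopProb hd)
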